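/- Let σ > 0 be a constant with σ ≠ 2, and let u, v be a real-valued classical solution of the Goldstein–Taylor system ∂ₜu + ∂ₓv = 0, ∂ₜv + ∂ₓu = −σ v on 𝕋 × (0,∞) with initial data u₀, v₀. Set f₊ := (u+v)/2, f₋ := (u−v)/2, f∞ := (u₀)_avg/2, μ(σ) := σ/2 if 0 < σ < 2 and μ(σ) := σ/2 − √(σ²/4 − 1) if σ > 2, and C_σ := √((2+σ)/(2−σ)) if 0 < σ < 2 and C_σ := √((σ+2)/(σ−2)) if σ > 2. Then for all t ≥ 0: √(‖f₊(·,t) − f∞‖² + ‖f₋(·,t) − f∞‖²) ≤ C_σ · √(‖f₊(·,0) − f∞‖² + ‖f₋(·,0) − f∞‖²) · e^{−μ(σ)t}. -/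

import Mathlib

open MeasureTheory Real

/-- Average of a (2π-periodic) function over one period. -/
noncomputable def havg (h : ℝ → ℝ) : ℝ := (1 / (2 * π)) * ∫ x in (0:ℝ)..(2 * π), h x

/-- Squared L²(𝕋) norm (normalized). -/
noncomputable def nsq (h : ℝ → ℝ) : ℝ := (1 / (2 * π)) * ∫ x in (0:ℝ)..(2 * π), (h x) ^ 2

/-- The anti-derivative ∂ₓ⁻¹ f with zero average. -/
noncomputable def antider (f : ℝ → ℝ) : ℝ → ℝ := fun x =>
  (∫ y in (0:ℝ)..x, f y) - havg (fun z => ∫ y in (0:ℝ)..z, f y)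

/-- The entropy functional E_θ(f,g). -/
noncomputable def entropyE (θ : ℝ) (f g : ℝ → ℝ) : ℝ :=
  nsq f + nsq g - (θ / (2 * π)) * ∫ x in (0:ℝ)..(2 * π), antider f x * g x

/-- Wirtinger's inequality for functions with zero mean and equal boundary values. -/
theorem integral_sq_le_integral_deriv_sq {f f' : ℝ → ℝ} (hf : ∀ x, HasDerivAt f (f' x) x)
    (hf' : Continuous f') (hper : f (2 * π) = f 0) (hmean : ∫ x in (0:ℝ)..(2 * π), f x = 0) :
    ∫ x in (0:ℝ)..(2 * π), f x ^ 2 ≤ ∫ x in (0:ℝ)..(2 * π), f' x ^ 2 := by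
  have hpi : (0:ℝ) < 2 * π := by positivity
  have hfc : Continuous f := continuous_iff_continuousAt.2 fun x => (hf x).continuousAt
  have parseval (g : ℝ → ℝ) (hg : Continuous g) :
      HasSum (fun i => ‖fourierCoeffOn hpi (fun x => (g x : ℂ)) i‖ ^ 2)
        ((2 * π)⁻¹ * ∫ x in (0:ℝ)..(2 * π), g x ^ 2) := by
    have hgc : Continuous fun x => (g x : ℂ) := Complex.continuous_ofReal.comp hg
    have hL2 : MemLp (fun x => (g x : ℂ)) 2 (volume.restrict (Set.Ioc 0 (2 * π))) := by
      obtain ⟨C, hC⟩ := isCompact_Icc.exists_bound_of_continuousOn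
        (s := Set.Icc (0:ℝ) (2 * π)) hgc.continuousOn
      refine MemLp.of_bound hgc.aestronglyMeasurable C ?_
      filter_upwards [ae_restrict_mem measurableSet_Ioc] with x hx
      exact hC x (Set.Ioc_subset_Icc_self hx)
    simpa using hasSum_sq_fourierCoeffOn hpi hL2
  have key := hasSum_le (fun n => ?_) (parseval f hfc) (parseval f' hf')
  · exact le_of_mul_le_mul_left key (by positivity)
  refine pow_le_pow_left₀ (norm_nonneg _) ?_ 2
  rcases eq_or_ne n 0 with rfl | hn
  · have : fourierCoeffOn hpi (fun x => (f x : ℂ)) 0 = 0 := by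
      rw [fourierCoeffOn_eq_integral]
      simp [intervalIntegral.integral_ofReal, hmean]
    rw [this, norm_zero]
    exact norm_nonneg _
  · have h := fourierCoeffOn_of_hasDerivAt hpi (n := n) hn (f := fun x => (f x : ℂ))
      (f' := fun x => (f' x : ℂ)) (fun x _ => (hf x).ofReal_comp)
      (Complex.continuous_ofReal.comp hf').continuousOn.intervalIntegrable
    have hn1 : (1:ℝ) ≤ |(n:ℝ)| := by exact_mod_cast Int.one_le_abs hn
    have hnC : (n : ℂ) ≠ 0 := by exact_mod_cast hn
    have hpiC : (π : ℂ) ≠ 0 := by exact_mod_cast pi_ne_zero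
    have h' : (n : ℂ) * Complex.I * fourierCoeffOn hpi (fun x => (f x : ℂ)) n =
        fourierCoeffOn hpi (fun x => (f' x : ℂ)) n := by
      rw [h, hper]
      push_cast
      field_simp [Complex.I_ne_zero]
      ring
    rw [← h', norm_mul, norm_mul, Complex.norm_I, mul_one, Complex.norm_intCast]
    exact le_mul_of_one_le_left (norm_nonneg _) hn1

/-- Differentiation under the integral sign at positive times. -/
theorem hasDerivAt_integral_of_continuous {F G : ℝ → ℝ → ℝ}
    (hF : Continuous (Function.uncurry F)) (hG : Continuous (Function.uncurry G))
    (hFG : ∀ t, 0 < t → ∀ x, HasDerivAt (fun s => F s x) (G t x) t) (a b : ℝ)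
    {t : ℝ} (ht : 0 < t) :
    HasDerivAt (fun s => ∫ x in a..b, F s x) (∫ x in a..b, G t x) t := by
  have hcF (s : ℝ) : Continuous (F s) := hF.comp (by fun_prop : Continuous fun x => (s, x))
  have hcG (s : ℝ) : Continuous (G s) := hG.comp (by fun_prop : Continuous fun x => (s, x))
  obtain ⟨C, hC⟩ := (isCompact_Icc.prod isCompact_uIcc).exists_bound_of_continuousOn
    (s := Set.Icc (t / 2) (2 * t) ×ˢ Set.uIcc a b) hG.continuousOn
  refine (intervalIntegral.hasDerivAt_integral_of_dominated_loc_of_deriv_le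
    (s := Set.Icc (t / 2) (2 * t)) (bound := fun _ => C)
    (Icc_mem_nhds (by linarith) (by linarith))
    (Filter.Eventually.of_forall fun s => (hcF s).aestronglyMeasurable)
    ((hcF t).intervalIntegrable _ _) (hcG t).aestronglyMeasurable
    (Filter.Eventually.of_forall fun x hx s hs => hC (s, x) ⟨hs, Set.uIoc_subset_uIcc hx⟩)
    intervalIntegrable_const
    (Filter.Eventually.of_forall fun x _ s hs => hFG s (by linarith [hs.1]) x)).2

/-- The `L²` pairing on a period of `v` with the zero-mean primitive of `w`. -/
noncomputable def primitivePairing (w v : ℝ → ℝ) : ℝ :=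
  (∫ x in (0:ℝ)..(2 * π), (∫ y in (0:ℝ)..x, w y) * v x) -
    (2 * π)⁻¹ * ((∫ x in (0:ℝ)..(2 * π), ∫ y in (0:ℝ)..x, w y) * ∫ x in (0:ℝ)..(2 * π), v x)

theorem two_mul_primitivePairing_le {w v : ℝ → ℝ} (hw : Continuous w) (hv : Continuous v)
    (hmean : ∫ x in (0:ℝ)..(2 * π), w x = 0) (α β : ℝ) :
    2 * (α * β) * primitivePairing w v ≤
      α ^ 2 * (∫ x in (0:ℝ)..(2 * π), w x ^ 2) + β ^ 2 * ∫ x in (0:ℝ)..(2 * π), v x ^ 2 := by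
  have hpi : (0:ℝ) < 2 * π := by positivity
  set P : ℝ → ℝ := fun x => ∫ y in (0:ℝ)..x, w y with hP
  have hPd (x : ℝ) : HasDerivAt P (w x) x :=
    intervalIntegral.integral_hasDerivAt_right (hw.intervalIntegrable _ _)
      (hw.stronglyMeasurableAtFilter _ _) hw.continuousAt
  have hPc : Continuous P := continuous_iff_continuousAt.2 fun x => (hPd x).continuousAt
  set c : ℝ := (2 * π)⁻¹ * ∫ x in (0:ℝ)..(2 * π), P x with hc
  have hwirt : ∫ x in (0:ℝ)..(2 * π), (P x - c) ^ 2 ≤ ∫ x in (0:ℝ)..(2 * π), w x ^ 2 := by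
    refine integral_sq_le_integral_deriv_sq (fun x => (hPd x).sub_const c) hw ?_ ?_
    · simp [hP, hmean]
    · rw [intervalIntegral.integral_sub (hPc.intervalIntegrable _ _) intervalIntegrable_const,
        intervalIntegral.integral_const, hc]
      simp only [sub_zero, smul_eq_mul]
      field_simp
      ring
  have hpair : primitivePairing w v = ∫ x in (0:ℝ)..(2 * π), (P x - c) * v x := by
    have : ∫ x in (0:ℝ)..(2 * π), (P x - c) * v x =
        (∫ x in (0:ℝ)..(2 * π), P x * v x) - c * ∫ x in (0:ℝ)..(2 * π), v x := by
      rw [← intervalIntegral.integral_const_mul, ← intervalIntegral.integral_sub]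
      · exact intervalIntegral.integral_congr fun x _ => sub_mul _ _ _
      all_goals exact Continuous.intervalIntegrable (by fun_prop) _ _
    rw [this, primitivePairing, hc, mul_assoc]
  have hsq : 0 ≤ ∫ x in (0:ℝ)..(2 * π), (α * (P x - c) - β * v x) ^ 2 :=
    intervalIntegral.integral_nonneg hpi.le fun x _ => sq_nonneg _
  have hexp : ∫ x in (0:ℝ)..(2 * π), (α * (P x - c) - β * v x) ^ 2 =
      α ^ 2 * (∫ x in (0:ℝ)..(2 * π), (P x - c) ^ 2) -
        2 * (α * β) * (∫ x in (0:ℝ)..(2 * π), (P x - c) * v x) +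
        β ^ 2 * ∫ x in (0:ℝ)..(2 * π), v x ^ 2 := by
    simp only [← intervalIntegral.integral_const_mul]
    rw [← intervalIntegral.integral_sub, ← intervalIntegral.integral_add]
    · exact intervalIntegral.integral_congr fun x _ => by ring
    all_goals exact Continuous.intervalIntegrable (by fun_prop) _ _
  rw [hpair]
  nlinarith [mul_le_mul_of_nonneg_left hwirt (sq_nonneg α)]

/-- A solution, for positive times, of the Goldstein–Taylor system with constant relaxation `σ`
and `2π`-periodic boundary conditions, together with continuous space derivatives `wx`, `vx`. -/
structure IsGoldsteinTaylor (σ : ℝ) (w v wx vx : ℝ → ℝ → ℝ) : Prop where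
  cont_w : Continuous (Function.uncurry w)
  cont_v : Continuous (Function.uncurry v)
  cont_wx : Continuous (Function.uncurry wx)
  cont_vx : Continuous (Function.uncurry vx)
  deriv_x_w : ∀ t, 0 < t → ∀ x, HasDerivAt (w t) (wx t x) x
  deriv_x_v : ∀ t, 0 < t → ∀ x, HasDerivAt (v t) (vx t x) x
  deriv_t_w : ∀ t, 0 < t → ∀ x, HasDerivAt (fun s => w s x) (-vx t x) t
  deriv_t_v : ∀ t, 0 < t → ∀ x, HasDerivAt (fun s => v s x) (-wx t x - σ * v t x) t
  periodic_w : ∀ t, w t (2 * π) = w t 0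
  periodic_v : ∀ t, v t (2 * π) = v t 0

namespace IsGoldsteinTaylor

variable {σ : ℝ} {w v wx vx : ℝ → ℝ → ℝ}

theorem cont_slices (h : IsGoldsteinTaylor σ w v wx vx) (t : ℝ) :
    Continuous (w t) ∧ Continuous (v t) ∧ Continuous (wx t) ∧ Continuous (vx t) :=
  have hm : Continuous fun x : ℝ => (t, x) := by fun_prop
  ⟨h.cont_w.comp hm, h.cont_v.comp hm, h.cont_wx.comp hm, h.cont_vx.comp hm⟩

theorem integral_vx (h : IsGoldsteinTaylor σ w v wx vx) {t : ℝ} (ht : 0 < t) (a b : ℝ) :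
    ∫ x in a..b, vx t x = v t b - v t a :=
  intervalIntegral.integral_eq_sub_of_hasDerivAt (fun x _ => h.deriv_x_v t ht x)
    ((h.cont_slices t).2.2.2.intervalIntegrable _ _)

theorem integral_wx (h : IsGoldsteinTaylor σ w v wx vx) {t : ℝ} (ht : 0 < t) (a b : ℝ) :
    ∫ x in a..b, wx t x = w t b - w t a :=
  intervalIntegral.integral_eq_sub_of_hasDerivAt (fun x _ => h.deriv_x_w t ht x)
    ((h.cont_slices t).2.2.1.intervalIntegrable _ _)

theorem hasDerivAt_primitive (h : IsGoldsteinTaylor σ w v wx vx) {t : ℝ} (ht : 0 < t) (x : ℝ) :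
    HasDerivAt (fun s => ∫ y in (0:ℝ)..x, w s y) (-(v t x - v t 0)) t := by
  have hcont : Continuous (Function.uncurry fun t x => -vx t x) := h.cont_vx.neg
  have := hasDerivAt_integral_of_continuous h.cont_w hcont h.deriv_t_w 0 x ht
  rwa [intervalIntegral.integral_neg, h.integral_vx ht] at this

theorem integral_eq_zero (h : IsGoldsteinTaylor σ w v wx vx)
    (h0 : ∫ x in (0:ℝ)..(2 * π), w 0 x = 0) {t : ℝ} (ht : 0 ≤ t) :
    ∫ x in (0:ℝ)..(2 * π), w t x = 0 := by
  have hcont : Continuous fun s => ∫ x in (0:ℝ)..(2 * π), w s x :=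
    intervalIntegral.continuous_parametric_intervalIntegral_of_continuous' h.cont_w _ _
  have hderiv (s : ℝ) (hs : s ∈ interior (Set.Ici (0:ℝ))) :
      HasDerivWithinAt (fun s => ∫ x in (0:ℝ)..(2 * π), w s x) 0 (interior (Set.Ici 0)) s := by
    have := h.hasDerivAt_primitive (by simpa using hs : 0 < s) (2 * π)
    rw [h.periodic_v, sub_self, neg_zero] at this
    exact this.hasDerivWithinAt
  have hanti := antitoneOn_of_hasDerivWithinAt_nonpos (convex_Ici 0) hcont.continuousOn hderiv
    fun _ _ => le_rfl
  have hmono := monotoneOn_of_hasDerivWithinAt_nonneg (convex_Ici 0) hcont.continuousOn hderiv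
    fun _ _ => le_rfl
  exact ((hanti Set.self_mem_Ici ht ht).antisymm (hmono Set.self_mem_Ici ht ht)).trans h0

theorem continuous_primitive (h : IsGoldsteinTaylor σ w v wx vx) :
    Continuous (Function.uncurry fun t x => ∫ y in (0:ℝ)..x, w t y) :=
  intervalIntegral.continuous_parametric_intervalIntegral_of_continuous
    (f := fun (p : ℝ × ℝ) y => w p.1 y) (s := fun p => p.2)
    (h.cont_w.comp (by fun_prop : Continuous fun q : (ℝ × ℝ) × ℝ => (q.1.1, q.2))) continuous_snd

theorem continuous_primitivePairing (h : IsGoldsteinTaylor σ w v wx vx) :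
    Continuous fun t => primitivePairing (w t) (v t) := by
  have hP := h.continuous_primitive
  have hPv : Continuous (Function.uncurry fun t x => (∫ y in (0:ℝ)..x, w t y) * v t x) :=
    hP.mul h.cont_v
  exact (intervalIntegral.continuous_parametric_intervalIntegral_of_continuous' hPv _ _).sub
    (continuous_const.mul
      ((intervalIntegral.continuous_parametric_intervalIntegral_of_continuous' hP _ _).mul
        (intervalIntegral.continuous_parametric_intervalIntegral_of_continuous' h.cont_v _ _)))

theorem hasDerivAt_primitivePairing (h : IsGoldsteinTaylor σ w v wx vx) {t : ℝ} (ht : 0 < t)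
    (hmean : ∫ x in (0:ℝ)..(2 * π), w t x = 0) :
    HasDerivAt (fun s => primitivePairing (w s) (v s))
      ((∫ x in (0:ℝ)..(2 * π), w t x ^ 2) - (∫ x in (0:ℝ)..(2 * π), v t x ^ 2) +
        (2 * π)⁻¹ * (∫ x in (0:ℝ)..(2 * π), v t x) ^ 2 -
        σ * primitivePairing (w t) (v t)) t := by
  obtain ⟨hw, hv, hwx, hvx⟩ := h.cont_slices t
  set P : ℝ → ℝ → ℝ := fun t x => ∫ y in (0:ℝ)..x, w t y with hP
  have hPc : Continuous (Function.uncurry P) := h.continuous_primitive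
  have hPt : Continuous (P t) := hPc.comp (by fun_prop : Continuous fun x : ℝ => (t, x))
  have hcw := h.cont_w
  have hcv := h.cont_v
  have hcwx := h.cont_wx
  have hcvx := h.cont_vx
  have hv0 : Continuous fun p : ℝ × ℝ => v p.1 0 :=
    hcv.comp (by fun_prop : Continuous fun p : ℝ × ℝ => (p.1, (0:ℝ)))
  simp only [Function.uncurry_def] at hPc hcw hcv hcwx hcvx
  have d1 : HasDerivAt (fun s => ∫ x in (0:ℝ)..(2 * π), P s x * v s x)
      (∫ x in (0:ℝ)..(2 * π), (-(v t x - v t 0) * v t x + P t x * (-wx t x - σ * v t x))) t :=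
    hasDerivAt_integral_of_continuous
      (G := fun t x => -(v t x - v t 0) * v t x + P t x * (-wx t x - σ * v t x))
      (F := fun t x => P t x * v t x) (by simp only [Function.uncurry_def]; fun_prop)
      (by simp only [Function.uncurry_def]; fun_prop)
      (fun s hs x => (h.hasDerivAt_primitive hs x).mul (h.deriv_t_v s hs x)) _ _ ht
  have d2 : HasDerivAt (fun s => ∫ x in (0:ℝ)..(2 * π), P s x)
      (∫ x in (0:ℝ)..(2 * π), -(v t x - v t 0)) t :=
    hasDerivAt_integral_of_continuous (G := fun t x => -(v t x - v t 0))
      (F := P) (by simp only [Function.uncurry_def]; fun_prop)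
      (by simp only [Function.uncurry_def]; fun_prop)
      (fun s hs x => h.hasDerivAt_primitive hs x) _ _ ht
  have d3 : HasDerivAt (fun s => ∫ x in (0:ℝ)..(2 * π), v s x)
      (∫ x in (0:ℝ)..(2 * π), (-wx t x - σ * v t x)) t :=
    hasDerivAt_integral_of_continuous (G := fun t x => -wx t x - σ * v t x)
      (F := v) (by simp only [Function.uncurry_def]; fun_prop)
      (by simp only [Function.uncurry_def]; fun_prop) h.deriv_t_v _ _ ht
  have e3 : ∫ x in (0:ℝ)..(2 * π), (-wx t x - σ * v t x) =
      -σ * ∫ x in (0:ℝ)..(2 * π), v t x := by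
    rw [intervalIntegral.integral_sub, intervalIntegral.integral_neg, h.integral_wx ht,
      h.periodic_w, intervalIntegral.integral_const_mul]
    · ring
    all_goals exact Continuous.intervalIntegrable (by fun_prop) _ _
  have e2 : ∫ x in (0:ℝ)..(2 * π), -(v t x - v t 0) =
      2 * π * v t 0 - ∫ x in (0:ℝ)..(2 * π), v t x := by
    rw [intervalIntegral.integral_neg, intervalIntegral.integral_sub,
      intervalIntegral.integral_const]
    · simp
    all_goals exact Continuous.intervalIntegrable (by fun_prop) _ _
  have hparts : ∫ x in (0:ℝ)..(2 * π), P t x * wx t x = -∫ x in (0:ℝ)..(2 * π), w t x ^ 2 := by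
    have := intervalIntegral.integral_mul_deriv_eq_deriv_mul (a := 0) (b := 2 * π)
      (u := P t) (v := w t) (u' := w t) (v' := wx t)
      (fun x _ => intervalIntegral.integral_hasDerivAt_right (hw.intervalIntegrable _ _)
        (hw.stronglyMeasurableAtFilter _ _) hw.continuousAt)
      (fun x _ => h.deriv_x_w t ht x) (hw.intervalIntegrable _ _) (hwx.intervalIntegrable _ _)
    rw [this]
    simp [hP, hmean, sq]
  have e1 : ∫ x in (0:ℝ)..(2 * π),
        (-(v t x - v t 0) * v t x + P t x * (-wx t x - σ * v t x)) =
      -(∫ x in (0:ℝ)..(2 * π), v t x ^ 2) + v t 0 * (∫ x in (0:ℝ)..(2 * π), v t x) +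
        (∫ x in (0:ℝ)..(2 * π), w t x ^ 2) - σ * ∫ x in (0:ℝ)..(2 * π), P t x * v t x := by
    rw [← neg_neg (∫ x in (0:ℝ)..(2 * π), w t x ^ 2), ← hparts]
    simp only [← intervalIntegral.integral_const_mul, ← intervalIntegral.integral_neg]
    rw [← intervalIntegral.integral_add, ← intervalIntegral.integral_add,
      ← intervalIntegral.integral_sub]
    · exact intervalIntegral.integral_congr fun x _ => by ring
    all_goals exact Continuous.intervalIntegrable (by fun_prop) _ _
  rw [e1] at d1
  rw [e2] at d2
  rw [e3] at d3
  have hpi : π ≠ 0 := pi_ne_zero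
  refine (d1.sub ((d2.mul d3).const_mul (2 * π)⁻¹)).congr_deriv ?_
  simp only [primitivePairing]
  field_simp
  ring

theorem hasDerivAt_integral_sq (h : IsGoldsteinTaylor σ w v wx vx) {t : ℝ} (ht : 0 < t) :
    HasDerivAt (fun s => (∫ x in (0:ℝ)..(2 * π), w s x ^ 2) + ∫ x in (0:ℝ)..(2 * π), v s x ^ 2)
      (-(2 * σ) * ∫ x in (0:ℝ)..(2 * π), v t x ^ 2) t := by
  obtain ⟨hw, hv, hwx, hvx⟩ := h.cont_slices t
  have hcw := h.cont_w
  have hcv := h.cont_v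
  have hcwx := h.cont_wx
  have hcvx := h.cont_vx
  simp only [Function.uncurry_def] at hcw hcv hcwx hcvx
  have d1 : HasDerivAt (fun s => ∫ x in (0:ℝ)..(2 * π), w s x ^ 2)
      (∫ x in (0:ℝ)..(2 * π), 2 * w t x * -vx t x) t :=
    hasDerivAt_integral_of_continuous (G := fun t x => 2 * w t x * -vx t x)
      (F := fun t x => w t x ^ 2) (by simp only [Function.uncurry_def]; fun_prop)
      (by simp only [Function.uncurry_def]; fun_prop)
      (fun s hs x => by simpa using (h.deriv_t_w s hs x).fun_pow 2) _ _ ht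
  have d2 : HasDerivAt (fun s => ∫ x in (0:ℝ)..(2 * π), v s x ^ 2)
      (∫ x in (0:ℝ)..(2 * π), 2 * v t x * (-wx t x - σ * v t x)) t :=
    hasDerivAt_integral_of_continuous (G := fun t x => 2 * v t x * (-wx t x - σ * v t x))
      (F := fun t x => v t x ^ 2) (by simp only [Function.uncurry_def]; fun_prop)
      (by simp only [Function.uncurry_def]; fun_prop)
      (fun s hs x => by simpa using (h.deriv_t_v s hs x).fun_pow 2) _ _ ht
  have hprod : ∫ x in (0:ℝ)..(2 * π), (wx t x * v t x + w t x * vx t x) = 0 := by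
    rw [intervalIntegral.integral_eq_sub_of_hasDerivAt
      (fun x _ => (h.deriv_x_w t ht x).mul (h.deriv_x_v t ht x))
      (Continuous.intervalIntegrable (by fun_prop) _ _)]
    simp [h.periodic_w, h.periodic_v]
  refine (d1.add d2).congr_deriv ?_
  suffices H : (∫ x in (0:ℝ)..(2 * π), 2 * w t x * -vx t x) +
      (∫ x in (0:ℝ)..(2 * π), 2 * v t x * (-wx t x - σ * v t x)) =
      -(2 * σ) * (∫ x in (0:ℝ)..(2 * π), v t x ^ 2) +
        -2 * ∫ x in (0:ℝ)..(2 * π), (wx t x * v t x + w t x * vx t x) by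
    rw [H, hprod, mul_zero, add_zero]
  simp only [← intervalIntegral.integral_const_mul]
  rw [← intervalIntegral.integral_add, ← intervalIntegral.integral_add]
  · exact intervalIntegral.integral_congr fun x _ => by ring
  all_goals exact Continuous.intervalIntegrable (by fun_prop) _ _

/-- Exponential decay of the energy, obtained from the entropy with parameter `θ`. -/
theorem energy_decay (h : IsGoldsteinTaylor σ w v wx vx)
    (h0 : ∫ x in (0:ℝ)..(2 * π), w 0 x = 0) {θ l α β : ℝ} (hθ : 0 ≤ θ)
    (hβ : 2 * σ - θ - l = β ^ 2) (hα : θ - l = α ^ 2) (hαβ : θ * (σ - l) = 2 * (α * β))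
    {t : ℝ} (ht : 0 ≤ t) :
    (2 - θ) * ((∫ x in (0:ℝ)..(2 * π), w t x ^ 2) + ∫ x in (0:ℝ)..(2 * π), v t x ^ 2) ≤
      (2 + θ) * ((∫ x in (0:ℝ)..(2 * π), w 0 x ^ 2) + ∫ x in (0:ℝ)..(2 * π), v 0 x ^ 2) *
        exp (-l * t) := by
  set N : ℝ → ℝ := fun t =>
    (∫ x in (0:ℝ)..(2 * π), w t x ^ 2) + ∫ x in (0:ℝ)..(2 * π), v t x ^ 2 with hN
  set E : ℝ → ℝ := fun t => N t - θ * primitivePairing (w t) (v t) with hE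
  have hNc : Continuous N :=
    (intervalIntegral.continuous_parametric_intervalIntegral_of_continuous'
      (f := fun t x => w t x ^ 2) (h.cont_w.fun_pow 2) _ _).add
    (intervalIntegral.continuous_parametric_intervalIntegral_of_continuous'
      (f := fun t x => v t x ^ 2) (h.cont_v.fun_pow 2) _ _)
  have hEc : Continuous E := hNc.sub (continuous_const.mul h.continuous_primitivePairing)
  have hpair {s : ℝ} (hs : 0 ≤ s) (α β : ℝ) := two_mul_primitivePairing_le
    (h.cont_slices s).1 (h.cont_slices s).2.1 (h.integral_eq_zero h0 hs) α β
  have hanti : AntitoneOn (fun s => E s * exp (l * s)) (Set.Ici 0) := by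
    have hd (s : ℝ) (hs : 0 < s) := ((h.hasDerivAt_integral_sq hs).sub
      ((h.hasDerivAt_primitivePairing hs (h.integral_eq_zero h0 hs.le)).const_mul θ)).mul
        (((hasDerivAt_id s).const_mul l).exp)
    refine antitoneOn_of_hasDerivWithinAt_nonpos (convex_Ici 0) (by fun_prop)
      (fun s hs => (hd s (by simpa using hs)).hasDerivWithinAt) fun s hs => ?_
    have hs : 0 < s := by simpa using hs
    have hp := hpair hs.le α β
    rw [← hα, ← hβ, ← hαβ] at hp
    have hm : 0 ≤ θ * ((2 * π)⁻¹ * (∫ x in (0:ℝ)..(2 * π), v s x) ^ 2) := by positivity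
    have hexp := exp_pos (l * s)
    simp only [id, mul_one, Pi.sub_apply]
    nlinarith [mul_le_mul_of_nonneg_right hp hexp.le, mul_nonneg hm hexp.le]
  have hle := hanti Set.self_mem_Ici ht ht
  simp only [mul_zero, exp_zero, mul_one] at hle
  have hEt : (2 - θ) * N t ≤ 2 * E t := by
    have := mul_le_mul_of_nonneg_left (hpair ht 1 1) hθ
    simp only [hE, hN]
    linarith
  have hE0 : 2 * E 0 ≤ (2 + θ) * N 0 := by
    have := mul_le_mul_of_nonneg_left (hpair le_rfl 1 (-1)) hθ
    simp only [hE, hN]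
    linarith
  calc (2 - θ) * N t ≤ 2 * E t := hEt
    _ = 2 * (E t * exp (l * t)) * exp (-l * t) := by
      rw [mul_assoc, mul_assoc, ← exp_add]; simp
    _ ≤ (2 + θ) * N 0 * exp (-l * t) := by
      exact mul_le_mul_of_nonneg_right (by linarith) (exp_pos _).le

end IsGoldsteinTaylor

theorem exists_continuous_partial_derivs {g : ℝ → ℝ → ℝ}
    (hg : ContDiffOn ℝ 1 (Function.uncurry g) (Set.Ici (0:ℝ) ×ˢ Set.univ)) :
    ∃ gt gx : ℝ → ℝ → ℝ, Continuous (Function.uncurry gt) ∧ Continuous (Function.uncurry gx) ∧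
      ∀ t, 0 < t → ∀ x, HasDerivAt (fun s => g s x) (gt t x) t ∧ HasDerivAt (g t) (gx t x) x := by
  set S : Set (ℝ × ℝ) := Set.Ici (0:ℝ) ×ˢ Set.univ
  have hSu : UniqueDiffOn ℝ S := (uniqueDiffOn_Ici 0).prod uniqueDiffOn_univ
  have hcont : Continuous fun p : ℝ × ℝ =>
      fderivWithin ℝ (Function.uncurry g) S (max p.1 0, p.2) :=
    (hg.continuousOn_fderivWithin hSu le_rfl).comp_continuous (by fun_prop)
      fun p => ⟨Set.mem_Ici.2 (le_max_right _ _), Set.mem_univ _⟩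
  refine ⟨fun t x => fderivWithin ℝ (Function.uncurry g) S (max t 0, x) (1, 0),
    fun t x => fderivWithin ℝ (Function.uncurry g) S (max t 0, x) (0, 1),
    hcont.clm_apply continuous_const, hcont.clm_apply continuous_const, fun t ht x => ?_⟩
  have hmem : S ∈ nhds (t, x) := prod_mem_nhds (Ici_mem_nhds ht) Filter.univ_mem
  have hd : HasFDerivAt (Function.uncurry g)
      (fderivWithin ℝ (Function.uncurry g) S (t, x)) (t, x) :=
    ((hg.differentiableOn one_ne_zero _ (mem_of_mem_nhds hmem)).hasFDerivWithinAt).hasFDerivAt hmem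
  simp only [max_eq_left ht.le]
  have h₁ : HasDerivAt (fun s => (s, x)) (1, 0) t := (hasDerivAt_id t).prodMk (hasDerivAt_const t x)
  have h₂ : HasDerivAt (fun y => (t, y)) (0, 1) x := (hasDerivAt_const x t).prodMk (hasDerivAt_id x)
  have k₁ := HasFDerivAt.comp_hasDerivAt (f := fun s => (s, x)) t hd h₁
  have k₂ := HasFDerivAt.comp_hasDerivAt (f := fun y => (t, y)) x hd h₂
  exact ⟨k₁, k₂⟩

theorem continuous_max_zero_of_continuousOn {g : ℝ → ℝ → ℝ}
    (hg : ContinuousOn (Function.uncurry g) (Set.Ici (0:ℝ) ×ˢ Set.univ)) :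
    Continuous (Function.uncurry fun t x => g (max t 0) x) :=
  hg.comp_continuous (f := fun p : ℝ × ℝ => (max p.1 0, p.2)) (by fun_prop)
    fun _ => ⟨Set.mem_Ici.2 (le_max_right _ _), Set.mem_univ _⟩

theorem nsq_add_nsq {f g : ℝ → ℝ} (hf : Continuous f) (hg : Continuous g) (a : ℝ) :
    nsq (fun x => (f x + g x) / 2 - a / 2) + nsq (fun x => (f x - g x) / 2 - a / 2) =
      (4 * π)⁻¹ *
        ((∫ x in (0:ℝ)..(2 * π), (f x - a) ^ 2) + ∫ x in (0:ℝ)..(2 * π), g x ^ 2) := by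
  unfold nsq
  rw [← mul_add, ← intervalIntegral.integral_add, ← intervalIntegral.integral_add]
  · simp only [← intervalIntegral.integral_const_mul]
    refine intervalIntegral.integral_congr fun x _ => ?_
    have := pi_ne_zero
    field_simp
    ring
  all_goals exact Continuous.intervalIntegrable (by fun_prop) _ _

theorem sqrt_le_of_energy_le {θ μ A B t : ℝ} (hθ : θ < 2) (hθ' : 0 ≤ 2 + θ)
    (h : (2 - θ) * A ≤ (2 + θ) * B * exp (-(2 * μ) * t)) :
    √A ≤ √((2 + θ) / (2 - θ)) * √B * exp (-μ * t) := by
  have hpos : 0 < 2 - θ := by linarith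
  have hexp : exp (-(2 * μ) * t) = exp (-μ * t) ^ 2 := by
    rw [← exp_nat_mul]
    congr 1
    push_cast
    ring
  rw [← sqrt_mul (by positivity), ← sqrt_sq (exp_pos (-μ * t)).le, ← hexp,
    ← sqrt_mul' _ (exp_pos _).le]
  refine sqrt_le_sqrt ?_
  rw [div_mul_eq_mul_div, div_mul_eq_mul_div, le_div_iff₀ hpos]
  linarith

/-- Theorem 1.1 (a), L² decay of f± for constant σ ≠ 2. -/
theorem gt_constant_L2_decay
    (σ : ℝ) (hσ0 : 0 < σ) (hσ2 : σ ≠ 2)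
    (u v : ℝ → ℝ → ℝ) (u₀ v₀ : ℝ → ℝ)
    (huC : ContDiffOn ℝ 1 (Function.uncurry u) (Set.Ici (0:ℝ) ×ˢ Set.univ))
    (hvC : ContDiffOn ℝ 1 (Function.uncurry v) (Set.Ici (0:ℝ) ×ˢ Set.univ))
    (hup : ∀ t, Function.Periodic (u t) (2 * π))
    (hvp : ∀ t, Function.Periodic (v t) (2 * π))
    (hpde1 : ∀ t, 0 < t → ∀ x, deriv (fun s => u s x) t + deriv (fun y => v t y) x = 0)
    (hpde2 : ∀ t, 0 < t → ∀ x,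
      deriv (fun s => v s x) t + deriv (fun y => u t y) x = -σ * v t x)
    (hu0 : ∀ x, u 0 x = u₀ x) (hv0 : ∀ x, v 0 x = v₀ x) :
    ∀ t, 0 ≤ t →
      Real.sqrt (nsq (fun x => (u t x + v t x) / 2 - havg u₀ / 2) +
          nsq (fun x => (u t x - v t x) / 2 - havg u₀ / 2)) ≤
        (if σ < 2 then Real.sqrt ((2 + σ) / (2 - σ)) else Real.sqrt ((σ + 2) / (σ - 2))) *
          Real.sqrt (nsq (fun x => (u₀ x + v₀ x) / 2 - havg u₀ / 2) +
            nsq (fun x => (u₀ x - v₀ x) / 2 - havg u₀ / 2)) *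
          Real.exp (-(if σ < 2 then σ / 2 else σ / 2 - Real.sqrt (σ ^ 2 / 4 - 1)) * t) := by
  intro t ht
  obtain ⟨ut, ux, -, hux, hu⟩ := exists_continuous_partial_derivs huC
  obtain ⟨vt, vx, -, hvx, hv⟩ := exists_continuous_partial_derivs hvC
  have hucont := continuous_max_zero_of_continuousOn huC.continuousOn
  have hvcont := continuous_max_zero_of_continuousOn hvC.continuousOn
  have hus (s : ℝ) (hs : 0 ≤ s) : Continuous (u s) := by
    simpa [hs, Function.comp_def] using
      hucont.comp (by fun_prop : Continuous fun x : ℝ => (s, x))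
  have hvs (s : ℝ) (hs : 0 ≤ s) : Continuous (v s) := by
    simpa [hs, Function.comp_def] using
      hvcont.comp (by fun_prop : Continuous fun x : ℝ => (s, x))
  obtain rfl : u 0 = u₀ := funext hu0
  obtain rfl : v 0 = v₀ := funext hv0
  set a : ℝ := havg (u 0) with ha
  have hext (f : ℝ → ℝ) {s : ℝ} (hs : 0 < s) : (fun s => f (max s 0)) =ᶠ[nhds s] f := by
    filter_upwards [lt_mem_nhds hs] with r hr
    rw [max_eq_left hr.le]
  have hGT : IsGoldsteinTaylor σ (fun t x => u (max t 0) x - a) (fun t x => v (max t 0) x) ux vx :=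
    { cont_w := hucont.sub continuous_const
      cont_v := hvcont
      cont_wx := hux
      cont_vx := hvx
      deriv_x_w := fun s hs x => by simpa [hs.le] using (hu s hs x).2.sub_const a
      deriv_x_v := fun s hs x => by simpa [hs.le] using (hv s hs x).2
      deriv_t_w := fun s hs x => by
        have h := hpde1 s hs x
        rw [(hu s hs x).1.deriv, (hv s hs x).2.deriv] at h
        rw [← eq_neg_of_add_eq_zero_left h]
        exact ((hu s hs x).1.sub_const a).congr_of_eventuallyEq
          (hext (fun r => u r x - a) hs)
      deriv_t_v := fun s hs x => by
        have h := hpde2 s hs x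
        rw [(hv s hs x).1.deriv, (hu s hs x).2.deriv] at h
        rw [max_eq_left hs.le, show -ux s x - σ * v s x = vt s x by linarith]
        exact (hv s hs x).1.congr_of_eventuallyEq (hext (fun r => v r x) hs)
      periodic_w := fun s => by simpa using hup (max s 0) 0
      periodic_v := fun s => by simpa using hvp (max s 0) 0 }
  have hmean : ∫ x in (0:ℝ)..(2 * π), (u (max 0 0) x - a) = 0 := by
    rw [max_self, intervalIntegral.integral_sub ((hus 0 le_rfl).intervalIntegrable _ _)
      intervalIntegrable_const, intervalIntegral.integral_const, ha, havg]
    have := pi_ne_zero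
    simp only [sub_zero, smul_eq_mul]
    field_simp
    ring
  have hdecay {θ l α β : ℝ} (hθ : 0 ≤ θ) (hβ : 2 * σ - θ - l = β ^ 2) (hα : θ - l = α ^ 2)
      (hαβ : θ * (σ - l) = 2 * (α * β)) :=
    hGT.energy_decay hmean hθ hβ hα hαβ ht
  simp only [max_self, max_eq_left ht] at hdecay
  rw [nsq_add_nsq (hus t ht) (hvs t ht), nsq_add_nsq (hus 0 le_rfl) (hvs 0 le_rfl)]
  set A : ℝ := (∫ x in (0:ℝ)..(2 * π), (u t x - a) ^ 2) + ∫ x in (0:ℝ)..(2 * π), v t x ^ 2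
  set B : ℝ := (∫ x in (0:ℝ)..(2 * π), (u 0 x - a) ^ 2) + ∫ x in (0:ℝ)..(2 * π), v 0 x ^ 2
  have hscale {θ l : ℝ} (h : (2 - θ) * A ≤ (2 + θ) * B * exp (-l * t)) :
      (2 - θ) * ((4 * π)⁻¹ * A) ≤ (2 + θ) * ((4 * π)⁻¹ * B) * exp (-l * t) := by
    have := mul_le_mul_of_nonneg_left h (by positivity : 0 ≤ (4 * π)⁻¹)
    linarith
  split_ifs with hlt
  · refine sqrt_le_of_energy_le hlt (by linarith) (hscale ?_)
    have := hdecay (θ := σ) (l := σ) (α := 0) (β := 0) hσ0.le (by ring) (by ring) (by ring)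
    rwa [mul_div_cancel₀ σ two_ne_zero]
  · have hgt : 2 < σ := lt_of_le_of_ne (not_lt.1 hlt) hσ2.symm
    set s : ℝ := √(σ ^ 2 / 4 - 1)
    have hs0 : 0 ≤ s := sqrt_nonneg _
    have hs : s ^ 2 = σ ^ 2 / 4 - 1 := sq_sqrt (by nlinarith)
    have hsσ : 2 * s ≤ σ := abs_le_of_sq_le_sq' (by nlinarith) hσ0.le |>.2
    have e1 : 4 / σ - 2 * (σ / 2 - s) = 2 * s * (σ - 2 * s) / σ := by
      field_simp
      linear_combination 4 * hs
    have e2 : 2 * σ - 4 / σ - 2 * (σ / 2 - s) = 2 * s * (σ + 2 * s) / σ := by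
      field_simp
      linear_combination -4 * hs
    have p1 : 0 ≤ 4 / σ - 2 * (σ / 2 - s) := by
      rw [e1]
      exact div_nonneg (mul_nonneg (by linarith) (by linarith)) hσ0.le
    have p2 : 0 ≤ 2 * σ - 4 / σ - 2 * (σ / 2 - s) := by
      rw [e2]
      positivity
    have hprod : √(4 / σ - 2 * (σ / 2 - s)) * √(2 * σ - 4 / σ - 2 * (σ / 2 - s)) =
        4 * s / σ := by
      rw [← sqrt_mul p1, e1, e2, ← sqrt_sq (by positivity : 0 ≤ 4 * s / σ)]
      congr 1
      field_simp
      linear_combination -16 * s ^ 2 * hs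
    have hθ0 : 0 < 4 / σ := by positivity
    have hθ : 4 / σ < 2 := by
      rw [div_lt_iff₀ hσ0]
      linarith
    have hC : (σ + 2) / (σ - 2) = (2 + 4 / σ) / (2 - 4 / σ) := by
      have h1 : σ - 2 ≠ 0 := by linarith
      have h2 : 2 - 4 / σ ≠ 0 := by linarith
      rw [div_eq_div_iff h1 h2]
      field_simp
      ring
    rw [hC]
    refine sqrt_le_of_energy_le hθ (by linarith) (hscale ?_)
    refine hdecay hθ0.le (sq_sqrt p2).symm (sq_sqrt p1).symm ?_
    rw [hprod]
    field_simp
    ring
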